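/- Suppose conditions (i), (ii), (iii), (iv), (v) and (vii) hold, and let p ≥ 1 satisfy p(α − κ_σ/2) < α. Then there exists a constant C(p) < ∞ such that for every x ∈ ℝ^d, ∫_0^T ∫_{ℝ^d} |ρ(x, x + u b(x) + √u σ(x) z, u)|^p · δ u^{α−1} exp(−δ u^α/α) · (2π)^{−d/2} exp(−‖z‖²/2) dz du ≤ C(p); that is, the p-th moment of the single incremental weight of the copycat CIS algorithm is bounded uniformly in the starting point x. -/

import Mathlib

open MeasureTheory ProbabilityTheory Matrix Real

/-- Partial derivative of a scalar function on `ℝ^d` along the `i`-th coordinate. -/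
noncomputable def pd {d : ℕ} (i : Fin d) (f : (Fin d → ℝ) → ℝ) (x : Fin d → ℝ) : ℝ :=
  deriv (fun t => f (Function.update x i t)) (x i)

/-- Frobenius norm of a `d × d` real matrix. -/
noncomputable def fnorm {d : ℕ} (A : Matrix (Fin d) (Fin d) ℝ) : ℝ :=
  Real.sqrt (∑ i, ∑ j, (A i j) ^ 2)

/-- Euclidean norm of a vector in `ℝ^d`. -/
noncomputable def vnorm {d : ℕ} (v : Fin d → ℝ) : ℝ :=
  Real.sqrt (∑ i, (v i) ^ 2)


lemma aux_abs_le_vnorm {d : ℕ} (v : Fin d → ℝ) (i : Fin d) : |v i| ≤ vnorm v := by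
  unfold vnorm
  apply Real.abs_le_sqrt
  exact Finset.single_le_sum (f := fun i => (v i) ^ 2) (fun j _ => sq_nonneg _) (Finset.mem_univ i)

lemma aux_abs_le_fnorm {d : ℕ} (A : Matrix (Fin d) (Fin d) ℝ) (i j : Fin d) : |A i j| ≤ fnorm A := by
  unfold fnorm
  apply Real.abs_le_sqrt
  calc (A i j) ^ 2 ≤ ∑ j, (A i j) ^ 2 :=
        Finset.single_le_sum (f := fun j => (A i j) ^ 2) (fun j _ => sq_nonneg _) (Finset.mem_univ j)
    _ ≤ _ := Finset.single_le_sum (f := fun i => ∑ j, (A i j) ^ 2)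
        (fun j _ => Finset.sum_nonneg fun k _ => sq_nonneg _) (Finset.mem_univ i)

lemma aux_vnorm_nonneg {d : ℕ} (v : Fin d → ℝ) : 0 ≤ vnorm v := Real.sqrt_nonneg _

lemma aux_fnorm_nonneg {d : ℕ} (v : Matrix (Fin d) (Fin d) ℝ) : 0 ≤ fnorm v := Real.sqrt_nonneg _

lemma aux_vnorm_eq {d : ℕ} (v : Fin d → ℝ) : vnorm v = ‖WithLp.toLp 2 v‖ := by
  simp [vnorm, EuclideanSpace.norm_eq]

lemma aux_vnorm_add {d : ℕ} (v w : Fin d → ℝ) : vnorm (v + w) ≤ vnorm v + vnorm w := by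
  simp only [aux_vnorm_eq, WithLp.toLp_add]
  exact norm_add_le _ _

lemma aux_vnorm_smul {d : ℕ} (a : ℝ) (v : Fin d → ℝ) : vnorm (a • v) = |a| * vnorm v := by
  simp only [aux_vnorm_eq, WithLp.toLp_smul, norm_smul, Real.norm_eq_abs]

lemma aux_vnorm_sq {d : ℕ} (v : Fin d → ℝ) : vnorm v ^ 2 = v ⬝ᵥ v := by
  unfold vnorm
  rw [Real.sq_sqrt (Finset.sum_nonneg fun k _ => sq_nonneg _)]
  simp [dotProduct, sq]

lemma aux_sum1 {d : ℕ} (f : Fin d → ℝ) (K : ℝ) (h : ∀ i, |f i| ≤ K) : |∑ i, f i| ≤ d * K := by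
  calc |∑ i, f i| ≤ ∑ i, |f i| := Finset.abs_sum_le_sum_abs _ _
    _ ≤ ∑ _i : Fin d, K := Finset.sum_le_sum fun i _ => h i
    _ = d * K := by simp

lemma aux_sum2 {d : ℕ} (f : Fin d → Fin d → ℝ) (K : ℝ) (h : ∀ i j, |f i j| ≤ K) :
    |∑ i, ∑ j, f i j| ≤ d * (d * K) :=
  aux_sum1 _ _ fun i => aux_sum1 _ _ fun j => h i j

lemma aux_unit {d : ℕ} (S : Matrix (Fin d) (Fin d) ℝ) (c : ℝ) (hc : 0 < c)
    (h : ∀ z, c * (z ⬝ᵥ z) ≤ z ⬝ᵥ ((S * Sᵀ) *ᵥ z)) : IsUnit S.det := by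
  have h1 : IsUnit Sᵀ := by
    rw [← Matrix.mulVec_injective_iff_isUnit]
    rw [← Matrix.coe_mulVecLin, injective_iff_map_eq_zero]
    intro z hz
    rw [Matrix.coe_mulVecLin] at hz
    have := h z
    rw [← Matrix.mulVec_mulVec, hz, Matrix.mulVec_zero, dotProduct_zero] at this
    have h2 : z ⬝ᵥ z ≤ 0 := by
      by_contra hh
      push Not at hh
      nlinarith [mul_pos hc hh]
    have h3 : z ⬝ᵥ z = 0 := le_antisymm h2 (by rw [← aux_vnorm_sq]; positivity)
    exact dotProduct_self_eq_zero.mp h3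
  rw [Matrix.isUnit_iff_isUnit_det, Matrix.det_transpose] at h1
  exact h1

lemma aux_frob {d : ℕ} (A A' W : Matrix (Fin d) (Fin d) ℝ) (v : Fin d → ℝ) :
    ∑ i, ∑ j, (A i j - A' i j) * (v i * v j - W i j)
      = v ⬝ᵥ ((A - A') *ᵥ v) - Matrix.trace ((A - A') * Wᵀ) := by
  simp only [dotProduct, Matrix.mulVec, Matrix.trace, Matrix.mul_apply, Matrix.diag,
    Matrix.transpose_apply, Matrix.sub_apply, Finset.mul_sum]
  rw [← Finset.sum_sub_distrib]
  refine Finset.sum_congr rfl fun i _ => ?_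
  rw [← Finset.sum_sub_distrib]
  refine Finset.sum_congr rfl fun j _ => ?_
  ring

/-- quadratic term identity and bound -/
lemma aux_Q {d : ℕ} (S S' : Matrix (Fin d) (Fin d) ℝ) (hS : IsUnit S.det) (z v : Fin d → ℝ)
    (hv : Sᵀ *ᵥ v = z) (X : Matrix (Fin d) (Fin d) ℝ)
    (hX : X = S⁻¹ * (S' - S) + (S⁻¹ * (S' - S))ᵀ + (S⁻¹ * (S' - S)) * (S⁻¹ * (S' - S))ᵀ) :
    ∑ i, ∑ j, ((S' * S'ᵀ) i j - (S * Sᵀ) i j) * (v i * v j - (S * Sᵀ)⁻¹ i j)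
      = (∑ i, ∑ j, z i * X i j * z j) - ∑ i, X i i := by
  set E := S⁻¹ * (S' - S) with hE
  have hS' : S' = S + S * E := by
    rw [hE, ← Matrix.mul_assoc, Matrix.mul_nonsing_inv _ hS]; simp
  have hH : S' * S'ᵀ - S * Sᵀ = S * X * Sᵀ := by
    rw [hX, hS']
    simp only [Matrix.transpose_add, Matrix.transpose_mul]
    noncomm_ring
  have hG : ((S * Sᵀ)⁻¹)ᵀ = (S * Sᵀ)⁻¹ := by
    rw [Matrix.transpose_nonsing_inv]; simp
  have h1 : ∑ i, ∑ j, ((S' * S'ᵀ) i j - (S * Sᵀ) i j) * (v i * v j - (S * Sᵀ)⁻¹ i j)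
      = v ⬝ᵥ ((S' * S'ᵀ - S * Sᵀ) *ᵥ v) - Matrix.trace ((S' * S'ᵀ - S * Sᵀ) * ((S * Sᵀ)⁻¹)ᵀ) := by
    exact aux_frob _ _ _ _
  rw [h1, hG, hH]
  congr 1
  · have : v ⬝ᵥ ((S * X * Sᵀ) *ᵥ v) = z ⬝ᵥ (X *ᵥ z) := by
      rw [← Matrix.mulVec_mulVec, ← Matrix.mulVec_mulVec, hv, Matrix.dotProduct_mulVec,
        ← Matrix.mulVec_transpose, hv]
    rw [this]
    simp only [dotProduct, Matrix.mulVec, Finset.mul_sum, mul_assoc]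
  · have hT : IsUnit (Sᵀ).det := by rwa [Matrix.det_transpose]
    rw [Matrix.mul_inv_rev, Matrix.mul_assoc, ← Matrix.mul_assoc Sᵀ, Matrix.mul_nonsing_inv _ hT,
      Matrix.one_mul, Matrix.trace_mul_comm, ← Matrix.mul_assoc, Matrix.nonsing_inv_mul _ hS,
      Matrix.one_mul]
    rfl

lemma aux_Qbound {d : ℕ} (E : Matrix (Fin d) (Fin d) ℝ) (z : Fin d → ℝ) (e R : ℝ)
    (he : fnorm E ≤ e) (hR : 1 + vnorm z ≤ R) :
    |(∑ i, ∑ j, z i * (E + Eᵀ + E * Eᵀ) i j * z j) - ∑ i, (E + Eᵀ + E * Eᵀ) i i|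
      ≤ (d * d + d) * (2 * e + d * e ^ 2) * R ^ 2 := by
  have hz := aux_vnorm_nonneg z
  have he0 := (aux_fnorm_nonneg E).trans he
  have hEij : ∀ i j, |E i j| ≤ e := fun i j => (aux_abs_le_fnorm E i j).trans he
  have hX : ∀ i j, |(E + Eᵀ + E * Eᵀ) i j| ≤ 2 * e + d * e ^ 2 := by
    intro i j
    have h3 : |(E * Eᵀ) i j| ≤ d * e ^ 2 := by
      rw [Matrix.mul_apply]
      apply aux_sum1
      intro k
      rw [abs_mul, sq]
      exact mul_le_mul (hEij _ _) (hEij _ _) (abs_nonneg _) he0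
    calc |(E + Eᵀ + E * Eᵀ) i j| ≤ |E i j + E j i| + |(E * Eᵀ) i j| := abs_add_le _ _
      _ ≤ |E i j| + |E j i| + |(E * Eᵀ) i j| := by gcongr; exact abs_add_le _ _
      _ ≤ e + e + d * e ^ 2 := by gcongr <;> apply hEij
      _ = _ := by ring
  have hK : 0 ≤ 2 * e + d * e ^ 2 := by positivity
  have hzi : ∀ i, |z i| ≤ R := fun i => (aux_abs_le_vnorm z i).trans (by linarith)
  have hR0 : 0 ≤ R := by linarith
  have h1 : |∑ i, ∑ j, z i * (E + Eᵀ + E * Eᵀ) i j * z j| ≤ d * (d * (R * (2 * e + d * e ^ 2) * R)) := by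
    apply aux_sum2
    intro i j
    rw [abs_mul, abs_mul]
    gcongr
    · exact hzi _
    · exact hX _ _
    · exact hzi _
  have h2 : |∑ i, (E + Eᵀ + E * Eᵀ) i i| ≤ d * (2 * e + d * e ^ 2) := aux_sum1 _ _ fun i => hX i i
  have h4 : (d:ℝ) * (2 * e + d * e ^ 2) ≤ d * (2 * e + d * e ^ 2) * R ^ 2 := by
    apply le_mul_of_one_le_right (by positivity)
    nlinarith
  calc _ ≤ _ := abs_sub _ _
    _ ≤ d * (d * (R * (2 * e + d * e ^ 2) * R)) + d * (2 * e + d * e ^ 2) * R ^ 2 := by linarith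
    _ = _ := by ring

/-- power bound -/
lemma aux_pow (w u R κ : ℝ) (N : ℕ) (hw0 : 0 ≤ w) (hu : 0 < u) (hR : 1 ≤ R)
    (hw : w ≤ √u * R) (hκ : 0 ≤ κ) (hN : κ ≤ N) : w ^ κ ≤ u ^ (κ / 2) * R ^ N := by
  calc w ^ κ ≤ (√u * R) ^ κ := Real.rpow_le_rpow hw0 hw hκ
    _ = u ^ (κ / 2) * R ^ κ := by
      rw [Real.mul_rpow (Real.sqrt_nonneg _) (by linarith), Real.sqrt_eq_rpow, ← Real.rpow_mul hu.le]
      congr 2; ring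
    _ ≤ u ^ (κ / 2) * R ^ N := by
      gcongr
      rw [← Real.rpow_natCast]
      exact Real.rpow_le_rpow_of_exponent_le hR hN

lemma aux_split (u T a b : ℝ) (hu : 0 < u) (hT : u ≤ T) (hab : a ≤ b) :
    u ^ b ≤ T ^ (b - a) * u ^ a := by
  have : u ^ b = u ^ (b - a) * u ^ a := by rw [← Real.rpow_add hu]; congr 1; ring
  rw [this]
  gcongr

lemma aux_Gint (d : ℕ) (B : ℝ) (hB : 0 ≤ B) (n : ℕ) :
    ∫⁻ z : Fin d → ℝ, ENNReal.ofReal ((1 + B * (1 + vnorm z)) ^ n * Real.exp (-(vnorm z) ^ 2 / 2)) ≠ ⊤ := by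
  have hi : Integrable (fun z : Fin d → ℝ => ∏ i, Real.exp (-(1/4) * (z i) ^ 2)) := by
    exact Integrable.fintype_prod (f := fun (_ : Fin d) (t : ℝ) => Real.exp (-(1/4) * t ^ 2))
      (fun i => integrable_exp_neg_mul_sq (by norm_num))
  have hi2 := hi.const_mul ((n.factorial : ℝ) * Real.exp (1 + B + B ^ 2))
  refine ne_top_of_le_ne_top hi2.lintegral_lt_top.ne (lintegral_mono fun z => ?_)
  apply ENNReal.ofReal_le_ofReal
  have hz := aux_vnorm_nonneg z
  have h1 : (1 + B * (1 + vnorm z)) ^ n ≤ n.factorial * Real.exp (1 + B * (1 + vnorm z)) := by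
    have := Real.pow_div_factorial_le_exp (1 + B * (1 + vnorm z)) (by positivity) n
    rwa [div_le_iff₀' (by positivity)] at this
  have h2 : ∏ i, Real.exp (-(1/4) * (z i) ^ 2) = Real.exp (-(1/4) * vnorm z ^ 2) := by
    rw [← Real.exp_sum, ← Finset.mul_sum, vnorm,
      Real.sq_sqrt (Finset.sum_nonneg fun k _ => sq_nonneg _)]
  rw [h2]
  calc _ ≤ (n.factorial * Real.exp (1 + B * (1 + vnorm z))) * Real.exp (-(vnorm z) ^ 2 / 2) := by gcongr
    _ = n.factorial * Real.exp (1 + B * (1 + vnorm z) + -(vnorm z) ^ 2 / 2) := by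
      rw [Real.exp_add (1 + B * (1 + vnorm z))]; ring
    _ ≤ n.factorial * Real.exp (1 + B + B ^ 2 + -(1/4) * vnorm z ^ 2) := by
      refine mul_le_mul_of_nonneg_left (Real.exp_le_exp.2 ?_) (by positivity)
      nlinarith [sq_nonneg (vnorm z / 2 - B)]
    _ = _ := by rw [Real.exp_add (1 + B + B ^ 2)]; ring

lemma aux_Fint (T q p α : ℝ) (hT : 0 < T) (hp : 1 ≤ p) (hα : 0 < α) (hq : -α < q * p) :
    ∫⁻ u in Set.Ioo (0 : ℝ) T, ENNReal.ofReal ((1 + u ^ q) ^ p * u ^ (α - 1)) ≠ ⊤ := by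
  have key : ∀ s : ℝ, -1 < s → IntegrableOn (fun u : ℝ => u ^ s) (Set.Ioo 0 T) := fun s hs =>
    (intervalIntegral.integrableOn_Ioo_rpow_iff hT).2 hs
  have hi := ((key (α - 1) (by linarith)).add (key (q * p + (α - 1)) (by linarith))).const_mul
    ((2:ℝ) ^ (p - 1))
  refine ne_top_of_le_ne_top hi.lintegral_lt_top.ne (setLIntegral_mono' measurableSet_Ioo fun u hu => ?_)
  apply ENNReal.ofReal_le_ofReal
  have hu0 := hu.1
  have h1 : (1 + u ^ q) ^ p ≤ 2 ^ (p - 1) * (1 ^ p + (u ^ q) ^ p) :=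
    by exact_mod_cast NNReal.rpow_add_le_mul_rpow_add_rpow 1 ⟨u ^ q, by positivity⟩ hp
  rw [Real.one_rpow, ← Real.rpow_mul hu0.le] at h1
  calc _ ≤ 2 ^ (p - 1) * (1 + u ^ (q * p)) * u ^ (α - 1) := by gcongr
    _ = _ := by simp only [Pi.add_apply]; rw [Real.rpow_add hu0]; ring

lemma aux_final (u T α κ δ Q L g2 tr R cQ cL cg ct : ℝ) (n : ℕ) (hu : 0 < u) (huT : u ≤ T)
    (hδ : 0 < δ) (hκ1 : κ ≤ 1) (hR : 1 ≤ R)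
    (hQ : |Q| ≤ cQ * u ^ (κ / 2) * R ^ n) (hL : |L| ≤ cL * R ^ n) (hg : |g2| ≤ cg) (ht : |tr| ≤ ct) :
    |1 + (1 / (δ * u ^ (α - 1))) * ((1 / 2) * (1 / u * Q + g2) + (√u)⁻¹ * L - tr)|
      ≤ (1 + (1 / δ) * (cQ + cg * T ^ (1 - κ / 2) + cL * T ^ ((1 - κ) / 2) + ct * T ^ (1 - κ / 2)))
        * ((1 + u ^ (κ / 2 - α)) * R ^ n) := by
  have hRn : 1 ≤ R ^ n := one_le_pow₀ hR
  have hU : 0 < u ^ (κ / 2 - α) := by positivity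
  set U := u ^ (κ / 2 - α) with hUdef
  have hcg : 0 ≤ cg := (abs_nonneg _).trans hg
  have hct : 0 ≤ ct := (abs_nonneg _).trans ht
  have hcL : 0 ≤ cL := by
    have := (abs_nonneg _).trans hL
    exact nonneg_of_mul_nonneg_left this (by positivity)
  have hcQ : 0 ≤ cQ := by
    have := (abs_nonneg _).trans hQ
    rw [mul_assoc] at this
    exact nonneg_of_mul_nonneg_left this (by positivity)
  have hT : 0 < T := hu.trans_le huT
  have e1 : 1 / (δ * u ^ (α - 1)) = (1 / δ) * u ^ (1 - α) := by
    rw [show 1 - α = -(α - 1) by ring, Real.rpow_neg hu.le]; field_simp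
  have e2 : u ^ (1 - α) * (1 / u) * u ^ (κ / 2) = U := by
    rw [one_div, ← Real.rpow_neg_one u, ← Real.rpow_add hu, ← Real.rpow_add hu, hUdef]; congr 1; ring
  have e3 : u ^ (1 - α) ≤ T ^ (1 - κ / 2) * U := by
    have := aux_split u T (κ / 2 - α) (1 - α) hu huT (by linarith)
    rwa [show 1 - α - (κ / 2 - α) = 1 - κ / 2 by ring] at this
  have e4 : u ^ (1 - α) * (√u)⁻¹ ≤ T ^ ((1 - κ) / 2) * U := by
    have := aux_split u T (κ / 2 - α) (1 / 2 - α) hu huT (by linarith)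
    rw [show 1 / 2 - α - (κ / 2 - α) = (1 - κ) / 2 by ring] at this
    rw [Real.sqrt_eq_rpow, ← Real.rpow_neg hu.le, ← Real.rpow_add hu]
    rwa [show 1 - α + -(1 / 2) = 1 / 2 - α by ring]
  have hW : 0 < u ^ (1 - α) := by positivity
  set W := u ^ (1 - α) with hWdef
  have t1 : |W * (1 / u * Q)| ≤ cQ * (U * R ^ n) := by
    rw [← mul_assoc, abs_mul, abs_of_nonneg (by positivity : 0 ≤ W * (1 / u))]
    calc _ ≤ W * (1 / u) * (cQ * u ^ (κ / 2) * R ^ n) := by gcongr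
      _ = cQ * ((W * (1 / u) * u ^ (κ / 2)) * R ^ n) := by ring
      _ = _ := by rw [e2]
  have t2 : |W * g2| ≤ cg * T ^ (1 - κ / 2) * (U * R ^ n) := by
    rw [abs_mul, abs_of_pos hW]
    calc _ ≤ (T ^ (1 - κ / 2) * U) * cg := by gcongr
      _ = cg * T ^ (1 - κ / 2) * (U * 1) := by ring
      _ ≤ _ := by gcongr
  have t3 : |W * tr| ≤ ct * T ^ (1 - κ / 2) * (U * R ^ n) := by
    rw [abs_mul, abs_of_pos hW]
    calc _ ≤ (T ^ (1 - κ / 2) * U) * ct := by gcongr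
      _ = ct * T ^ (1 - κ / 2) * (U * 1) := by ring
      _ ≤ _ := by gcongr
  have t4 : |W * ((√u)⁻¹ * L)| ≤ cL * T ^ ((1 - κ) / 2) * (U * R ^ n) := by
    rw [← mul_assoc, abs_mul, abs_of_nonneg (by positivity : 0 ≤ W * (√u)⁻¹)]
    calc _ ≤ (T ^ ((1 - κ) / 2) * U) * (cL * R ^ n) := by gcongr
      _ = _ := by ring
  rw [e1]
  set D := cQ + cg * T ^ (1 - κ / 2) + cL * T ^ ((1 - κ) / 2) + ct * T ^ (1 - κ / 2) with hD
  have hD0 : 0 ≤ D := by positivity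
  have s1 : |W * ((1 / 2) * (1 / u * Q + g2) + (√u)⁻¹ * L - tr)| ≤ D * (U * R ^ n) := by
    have n1 := (abs_nonneg _).trans t1
    have n2 := (abs_nonneg _).trans t2
    have : W * ((1 / 2) * (1 / u * Q + g2) + (√u)⁻¹ * L - tr)
      = (1 / 2) * (W * (1 / u * Q)) + (1 / 2) * (W * g2) + W * ((√u)⁻¹ * L) - W * tr := by ring
    rw [this, hD, add_mul, add_mul, add_mul]
    rw [abs_le] at *
    constructor <;> linarith [t1.1, t1.2, t2.1, t2.2, t3.1, t3.2, t4.1, t4.2]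
  calc _ ≤ |(1:ℝ)| + |(1 / δ) * W * ((1 / 2) * (1 / u * Q + g2) + (√u)⁻¹ * L - tr)| := abs_add_le _ _
    _ ≤ 1 + (1 / δ) * (D * (U * R ^ n)) := by
      rw [mul_assoc, abs_mul, abs_one, abs_of_pos (by positivity : 0 < 1 / δ)]
      gcongr
    _ ≤ _ := by
      have a1 : 0 ≤ (1 / δ) * D * R ^ n := by positivity
      have a2 : 0 ≤ U * R ^ n := by positivity
      nlinarith

set_option maxHeartbeats 4000000 in
/-- **Uniform boundedness of the `p`-th moment of the single incremental weight of the
copycat CIS algorithm, case (b)** (Proposition 6.9(b) of the paper). -/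
theorem copycat_cis_incremental_moment_bound_sigma
    {d : ℕ} (hd : 1 ≤ d)
    (b : (Fin d → ℝ) → (Fin d → ℝ)) (σ : (Fin d → ℝ) → Matrix (Fin d) (Fin d) ℝ)
    (γ : (Fin d → ℝ) → Matrix (Fin d) (Fin d) ℝ)
    (hγdef : ∀ x, γ x = σ x * (σ x)ᵀ)
    -- derived functions
    (b1 : (Fin d → ℝ) → Fin d → ℝ)
    (hb1 : ∀ x i, b1 x i = pd i (fun y => b y i) x)
    (γ1 γ2 : (Fin d → ℝ) → Matrix (Fin d) (Fin d) ℝ)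
    (hγ1 : ∀ x i j, γ1 x i j = pd j (fun y => γ y i j) x)
    (hγ2 : ∀ x i j, γ2 x i j = pd i (fun y => pd j (fun y' => γ y' i j) y) x)
    -- conditions (i)-(vi)
    (C : ℝ) (κb : ℝ) (hκb : 0 < κb)
    (hcond_i : ∀ x y, vnorm ((σ x)⁻¹ *ᵥ (b y - b x)) ≤
      C * (1 + vnorm ((σ x)⁻¹ *ᵥ (y - x)) ^ κb))
    (hcond_ii : ∀ x, vnorm ((σ x)⁻¹ *ᵥ b x) ≤ C)
    (hcond_iii_ex : ∀ x i, DifferentiableAt ℝ (fun t => b (Function.update x i t) i) (x i))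
    (hcond_iii : ∀ x, vnorm (b1 x) ≤ C)
    (hcond_iv_ex1 : ∀ x i j,
      DifferentiableAt ℝ (fun t => γ (Function.update x j t) i j) (x j))
    (hcond_iv_ex2 : ∀ x i j,
      DifferentiableAt ℝ (fun t => pd j (fun y => γ y i j) (Function.update x i t)) (x i))
    (hcond_iv1 : ∀ x, fnorm (γ1 x) ≤ C)
    (hcond_iv2 : ∀ x, fnorm (γ2 x) ≤ C)
    (c : ℝ) (hc : 0 < c)
    (hcond_v : ∀ x z, c * (z ⬝ᵥ z) ≤ z ⬝ᵥ (γ x *ᵥ z))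
    (κσ m : ℝ) (hκσ0 : 0 < κσ) (hκσ1 : κσ ≤ 1) (hm : κσ < m)
    (hcond_vii : ∀ x y, fnorm ((σ x)⁻¹ * (σ y - σ x)) ≤
      C * (vnorm ((σ x)⁻¹ *ᵥ (y - x)) ^ κσ + vnorm ((σ x)⁻¹ *ᵥ (y - x)) ^ m))
    (T δ α : ℝ) (hT : 0 < T) (hδ : 0 < δ) (hα0 : 0 < α) (hα1 : α < 1)
    -- incremental weight
    (Λ : (Fin d → ℝ) → (Fin d → ℝ) → ℝ → (Fin d → ℝ))
    (hΛ : ∀ x y u, Λ x y u = -(1 / u) • ((γ x)⁻¹ *ᵥ (y - x - u • b x)))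
    (Ktil : (Fin d → ℝ) → (Fin d → ℝ) → ℝ → Matrix (Fin d) (Fin d) ℝ)
    (hKtil : ∀ x y u, Ktil x y u = vecMulVec (Λ x y u) (Λ x y u) - (1 / u) • (γ x)⁻¹)
    (ρ : (Fin d → ℝ) → (Fin d → ℝ) → ℝ → ℝ)
    (hρ : ∀ x y u, ρ x y u = 1 + (1 / (δ * u ^ (α - 1))) *
      ((1 / 2) * ((∑ i, ∑ j, (γ y i j - γ x i j) * Ktil x y u i j)
          + ∑ i, ∑ j, γ2 y i j)
        + (∑ i, ((∑ j, γ1 y i j) - b y i + b x i) * Λ x y u i)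
        - ∑ i, b1 y i))
    (p : ℝ) (hp : 1 ≤ p) (hpα : p * (α - κσ / 2) < α) :
    ∃ Cp : ℝ, ∀ x : Fin d → ℝ,
      (∫⁻ u in Set.Ioo (0 : ℝ) T, ∫⁻ z : Fin d → ℝ,
        ENNReal.ofReal
          (|ρ x (x + u • b x + Real.sqrt u • (σ x *ᵥ z)) u| ^ p
            * (δ * u ^ (α - 1) * Real.exp (-δ * u ^ α / α))
            * ((2 * π) ^ (-(d : ℝ) / 2) * Real.exp (-(vnorm z) ^ 2 / 2)))) ≤
        ENNReal.ofReal Cp := by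
  have hC : 0 ≤ C := (aux_vnorm_nonneg _).trans (hcond_ii 0)
  obtain ⟨N, hN⟩ := exists_nat_ge (max m κb)
  have hNm : m ≤ N := (le_max_left _ _).trans hN
  have hNb : κb ≤ N := (le_max_right _ _).trans hN
  have hNκ : κσ ≤ N := by linarith
  set B := C * √T + 1 with hB
  have hB1 : 1 ≤ B := by
    have : 0 ≤ C * √T := by positivity
    linarith
  set cE := C * (1 + T ^ ((m - κσ) / 2)) with hcE
  have hcE0 : 0 ≤ cE := by positivity
  set cQ := ((d:ℝ) * d + d) * (2 * cE + d * (cE ^ 2 * T ^ (κσ / 2))) with hcQ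
  set cL := (d:ℝ) * (d * C * (√c)⁻¹) + d * (C * (1 + T ^ (κb / 2))) with hcL
  obtain ⟨A, hA⟩ : ∃ A, A = (1 + (1 / δ) * (cQ + (d * (d * C)) * T ^ (1 - κσ / 2)
    + cL * T ^ ((1 - κσ) / 2) + (d * C) * T ^ (1 - κσ / 2))) := ⟨_, rfl⟩
  have hA0 : 0 ≤ A := by rw [hA]; positivity
  set n := 2 * N + 2 with hn
  have key : ∀ x z u, u ∈ Set.Ioo 0 T →
      |ρ x (x + u • b x + Real.sqrt u • (σ x *ᵥ z)) u| ≤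
        A * ((1 + u ^ (κσ / 2 - α)) * (1 + B * (1 + vnorm z)) ^ n) := by
    intro x z u hu
    obtain ⟨hu0, huT⟩ := hu
    have hz := aux_vnorm_nonneg z
    obtain ⟨y, hy⟩ : ∃ y, y = x + u • b x + Real.sqrt u • (σ x *ᵥ z) := ⟨_, rfl⟩
    obtain ⟨R, hRdef⟩ : ∃ R, R = 1 + B * (1 + vnorm z) := ⟨_, rfl⟩
    have hRz : 1 + vnorm z ≤ R := by rw [hRdef]; nlinarith
    have hR1 : 1 ≤ R := by linarith
    have hR0 : 0 ≤ R := by linarith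
    rw [← hy, ← hRdef]
    have hS : IsUnit (σ x).det := aux_unit _ c hc (by
      intro z; have := hcond_v x z; rwa [hγdef] at this)
    have hT' : IsUnit ((σ x)ᵀ).det := by rwa [Matrix.det_transpose]
    have hsu : 0 < √u := Real.sqrt_pos.2 hu0
    -- the scaled displacement
    have hw : vnorm ((σ x)⁻¹ *ᵥ (y - x)) ≤ √u * R := by
      have : (σ x)⁻¹ *ᵥ (y - x) = u • ((σ x)⁻¹ *ᵥ b x) + √u • z := by
        rw [hy, add_assoc, add_sub_cancel_left, Matrix.mulVec_add, Matrix.mulVec_smul,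
          Matrix.mulVec_smul, Matrix.mulVec_mulVec, Matrix.nonsing_inv_mul _ hS, Matrix.one_mulVec]
      rw [this]
      refine (aux_vnorm_add _ _).trans ?_
      rw [aux_vnorm_smul, aux_vnorm_smul, abs_of_pos hu0, abs_of_pos hsu]
      have h1 : √u ≤ √T := Real.sqrt_le_sqrt huT.le
      calc u * vnorm ((σ x)⁻¹ *ᵥ b x) + √u * vnorm z ≤ u * C + √u * vnorm z := by
            gcongr; exact hcond_ii x
        _ = √u * (√u * C + vnorm z) := by
          nth_rewrite 1 [← Real.mul_self_sqrt hu0.le]; ring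
        _ ≤ √u * (√T * C + vnorm z) := by gcongr
        _ ≤ √u * R := by
          gcongr
          rw [hRdef, hB]
          nlinarith [mul_nonneg (mul_nonneg hC (Real.sqrt_nonneg T)) hz]
    have hw0 := aux_vnorm_nonneg ((σ x)⁻¹ *ᵥ (y - x))
    obtain ⟨w, hwdef⟩ : ∃ w, w = vnorm ((σ x)⁻¹ *ᵥ (y - x)) := ⟨_, rfl⟩
    have hc7 := hcond_vii x y
    have hc1 := hcond_i x y
    rw [← hwdef] at hw hw0 hc7 hc1
    have hE : fnorm ((σ x)⁻¹ * (σ y - σ x)) ≤ cE * u ^ (κσ / 2) * R ^ N := by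
      refine hc7.trans ?_
      have h1 := aux_pow w u R κσ N hw0 hu0 hR1 hw hκσ0.le hNκ
      have h2 := aux_pow w u R m N hw0 hu0 hR1 hw (by linarith) hNm
      have h3 := aux_split u T (κσ / 2) (m / 2) hu0 huT.le (by linarith)
      rw [show m / 2 - κσ / 2 = (m - κσ) / 2 by ring] at h3
      calc C * (w ^ κσ + w ^ m)
          ≤ C * (u ^ (κσ / 2) * R ^ N + (T ^ ((m - κσ) / 2) * u ^ (κσ / 2)) * R ^ N) := by
            gcongr
            exact h2.trans (by gcongr)
        _ = _ := by rw [hcE]; ring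
    have hβ : vnorm ((σ x)⁻¹ *ᵥ (b y - b x)) ≤ C * (1 + T ^ (κb / 2)) * R ^ N := by
      refine hc1.trans ?_
      have h1 := aux_pow w u R κb N hw0 hu0 hR1 hw hκb.le hNb
      have h2 : u ^ (κb / 2) ≤ T ^ (κb / 2) := Real.rpow_le_rpow hu0.le huT.le (by linarith)
      have h3 : 1 ≤ R ^ N := one_le_pow₀ hR1
      calc C * (1 + w ^ κb) ≤ C * (R ^ N + T ^ (κb / 2) * R ^ N) := by
            gcongr
            exact h1.trans (by gcongr)
        _ = _ := by ring
    obtain ⟨v, hv⟩ : ∃ v, v = ((σ x)ᵀ)⁻¹ *ᵥ z := ⟨_, rfl⟩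
    have hvz : (σ x)ᵀ *ᵥ v = z := by
      rw [hv, Matrix.mulVec_mulVec, Matrix.mul_nonsing_inv _ hT', Matrix.one_mulVec]
    have hvn : vnorm v ≤ (√c)⁻¹ * vnorm z := by
      have h1 := hcond_v x v
      rw [hγdef, ← Matrix.mulVec_mulVec, hvz, Matrix.dotProduct_mulVec, ← Matrix.mulVec_transpose,
        hvz, ← aux_vnorm_sq, ← aux_vnorm_sq] at h1
      have hcs : 0 < √c := Real.sqrt_pos.2 hc
      rw [inv_mul_eq_div, le_div_iff₀ hcs]
      apply le_of_sq_le_sq _ hz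
      rw [mul_pow, Real.sq_sqrt hc.le]; linarith
    have hΛv : Λ x y u = -((√u)⁻¹ • v) := by
      rw [hΛ, hy, hγdef]
      have : x + u • b x + √u • (σ x *ᵥ z) - x - u • b x = √u • (σ x *ᵥ z) := by abel
      rw [this, Matrix.mul_inv_rev, Matrix.mulVec_smul, ← Matrix.mulVec_mulVec,
        Matrix.mulVec_mulVec z, Matrix.nonsing_inv_mul _ hS, Matrix.one_mulVec, ← hv, smul_smul,
        ← neg_smul]
      congr 1
      rw [neg_mul, one_div, neg_inj]
      nth_rewrite 1 [← Real.mul_self_sqrt hu0.le]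
      field_simp
    have hK : ∀ i j, Ktil x y u i j = (1 / u) * (v i * v j - (σ x * (σ x)ᵀ)⁻¹ i j) := by
      intro i j
      rw [hKtil, hΛv, hγdef]
      simp only [Matrix.sub_apply, Matrix.vecMulVec_apply, Matrix.smul_apply, Pi.neg_apply,
        Pi.smul_apply, smul_eq_mul]
      have : (√u)⁻¹ * (√u)⁻¹ = 1 / u := by
        rw [← mul_inv, Real.mul_self_sqrt hu0.le, one_div]
      linear_combination (v i * v j) * this
    obtain ⟨Q, hQ⟩ : ∃ Q, Q = ∑ i, ∑ j, (γ y i j - γ x i j) * (v i * v j - (σ x * (σ x)ᵀ)⁻¹ i j) :=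
      ⟨_, rfl⟩
    have hQs : (∑ i, ∑ j, (γ y i j - γ x i j) * Ktil x y u i j) = 1 / u * Q := by
      rw [hQ, Finset.mul_sum]
      refine Finset.sum_congr rfl fun i _ => ?_
      rw [Finset.mul_sum]
      refine Finset.sum_congr rfl fun j _ => ?_
      rw [hK]; ring
    have hQb : |Q| ≤ cQ * u ^ (κσ / 2) * R ^ n := by
      rw [hQ, hγdef, hγdef, aux_Q (σ x) (σ y) hS z v hvz _ rfl]
      refine (aux_Qbound _ z _ R hE hRz).trans ?_
      have h1 : u ^ (κσ / 2) ≤ T ^ (κσ / 2) := Real.rpow_le_rpow hu0.le huT.le (by linarith)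
      have h3 : 1 ≤ R ^ N := one_le_pow₀ hR1
      have h0 : 0 < u ^ (κσ / 2) := by positivity
      rw [hcQ, hn]
      calc ((d:ℝ) * d + d) * (2 * (cE * u ^ (κσ / 2) * R ^ N) + d * (cE * u ^ (κσ / 2) * R ^ N) ^ 2) * R ^ 2
          = ((d:ℝ) * d + d) * (2 * (cE * u ^ (κσ / 2) * (R ^ N * 1)) +
            d * (cE ^ 2 * u ^ (κσ / 2) * u ^ (κσ / 2) * (R ^ N * R ^ N))) * R ^ 2 := by ring
        _ ≤ ((d:ℝ) * d + d) * (2 * (cE * u ^ (κσ / 2) * (R ^ N * R ^ N)) +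
            d * (cE ^ 2 * T ^ (κσ / 2) * u ^ (κσ / 2) * (R ^ N * R ^ N))) * R ^ 2 := by gcongr
        _ = _ := by ring
    obtain ⟨L, hL⟩ : ∃ L, L = (∑ i, -((∑ j, γ1 y i j) * v i)) +
        ∑ i, ((σ x)⁻¹ *ᵥ (b y - b x)) i * z i := ⟨_, rfl⟩
    have hdot : ∑ i, ((σ x)⁻¹ *ᵥ (b y - b x)) i * z i = ∑ i, (b y i - b x i) * v i := by
      change ((σ x)⁻¹ *ᵥ (b y - b x)) ⬝ᵥ z = (b y - b x) ⬝ᵥ v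
      rw [hv, Matrix.dotProduct_mulVec, ← Matrix.mulVec_transpose, Matrix.transpose_nonsing_inv,
        Matrix.transpose_transpose]
    have hLs : (∑ i, ((∑ j, γ1 y i j) - b y i + b x i) * Λ x y u i) = (√u)⁻¹ * L := by
      rw [hL, hdot, ← Finset.sum_add_distrib, Finset.mul_sum]
      refine Finset.sum_congr rfl fun i _ => ?_
      rw [hΛv]
      simp only [Pi.neg_apply, Pi.smul_apply, smul_eq_mul]
      ring
    have hLb : |L| ≤ cL * R ^ n := by
      have hzi : ∀ i, |z i| ≤ R := fun i => (aux_abs_le_vnorm z i).trans (by linarith)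
      have h1 : |∑ i, -((∑ j, γ1 y i j) * v i)| ≤ d * (d * C * ((√c)⁻¹ * R)) := by
        apply aux_sum1
        intro i
        rw [abs_neg, abs_mul]
        gcongr
        · exact aux_sum1 _ _ fun j => (aux_abs_le_fnorm _ i j).trans (hcond_iv1 y)
        · refine (aux_abs_le_vnorm v i).trans (hvn.trans ?_)
          gcongr
          linarith
      have h2 : |∑ i, ((σ x)⁻¹ *ᵥ (b y - b x)) i * z i| ≤ d * (C * (1 + T ^ (κb / 2)) * R ^ N * R) := by
        apply aux_sum1
        intro i
        rw [abs_mul]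
        gcongr
        · exact (aux_abs_le_vnorm _ i).trans hβ
        · exact hzi i
      have p1 : R ≤ R ^ n := le_self_pow₀ hR1 (by omega)
      have p2 : R ^ N * R ≤ R ^ n := by
        rw [← pow_succ]; exact pow_le_pow_right₀ hR1 (by omega)
      rw [hL]
      calc _ ≤ _ := abs_add_le _ _
        _ ≤ d * (d * C * ((√c)⁻¹ * R)) + d * (C * (1 + T ^ (κb / 2)) * R ^ N * R) := add_le_add h1 h2
        _ = d * (d * C * (√c)⁻¹) * R + d * (C * (1 + T ^ (κb / 2))) * (R ^ N * R) := by ring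
        _ ≤ d * (d * C * (√c)⁻¹) * R ^ n + d * (C * (1 + T ^ (κb / 2))) * R ^ n := by gcongr
        _ = _ := by rw [hcL]; ring
    rw [hρ, hQs, hLs, hA]
    apply aux_final u T α κσ δ Q L _ _ R cQ cL _ _ n hu0 huT.le hδ hκσ1 hR1 hQb hLb
    · exact aux_sum2 _ _ fun i j => (aux_abs_le_fnorm _ i j).trans (hcond_iv2 y)
    · exact aux_sum1 _ _ fun i => (aux_abs_le_vnorm _ i).trans (hcond_iii y)
  -- integration
  obtain ⟨k, hk⟩ := exists_nat_ge ((n:ℝ) * p)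
  have hF := aux_Fint T (κσ / 2 - α) p α hT hp hα0 (by linarith)
  have hG := aux_Gint d B (by linarith) k
  have hp0 : 0 ≤ p := by linarith
  obtain ⟨D, hD⟩ : ∃ D, D = A ^ p * δ * (2 * π) ^ (-(d : ℝ) / 2) := ⟨_, rfl⟩
  have hD0 : 0 ≤ D := by rw [hD]; positivity
  set IF := ∫⁻ u in Set.Ioo (0 : ℝ) T, ENNReal.ofReal ((1 + u ^ (κσ / 2 - α)) ^ p * u ^ (α - 1))
  set IG := ∫⁻ z : Fin d → ℝ, ENNReal.ofReal ((1 + B * (1 + vnorm z)) ^ k * Real.exp (-(vnorm z) ^ 2 / 2)) with hIG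
  have hfin : ENNReal.ofReal D * IG * IF ≠ ⊤ :=
    ENNReal.mul_ne_top (ENNReal.mul_ne_top ENNReal.ofReal_ne_top hG) hF
  refine ⟨(ENNReal.ofReal D * IG * IF).toReal, fun x => ?_⟩
  rw [ENNReal.ofReal_toReal hfin]
  have hDG : ENNReal.ofReal D * IG ≠ ⊤ := ENNReal.mul_ne_top ENNReal.ofReal_ne_top hG
  rw [← lintegral_const_mul' _ _ hDG]
  refine setLIntegral_mono' measurableSet_Ioo fun u hu => ?_
  have hu0 := hu.1
  rw [mul_right_comm (ENNReal.ofReal D), ← ENNReal.ofReal_mul hD0, hIG, ← lintegral_const_mul' _ _ ENNReal.ofReal_ne_top]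
  refine lintegral_mono fun z => ?_
  have hz := aux_vnorm_nonneg z
  rw [← ENNReal.ofReal_mul (by positivity)]
  apply ENNReal.ofReal_le_ofReal
  obtain ⟨R, hRdef⟩ : ∃ R, R = 1 + B * (1 + vnorm z) := ⟨_, rfl⟩
  have hR1 : 1 ≤ R := by
    have : 0 ≤ B * (1 + vnorm z) := by positivity
    linarith
  have hk1 := key x z u hu
  rw [← hRdef] at hk1 ⊢
  have hR0 : 0 ≤ R := by linarith
  have hk2 : |ρ x (x + u • b x + Real.sqrt u • (σ x *ᵥ z)) u| ^ p ≤
      A ^ p * ((1 + u ^ (κσ / 2 - α)) ^ p * R ^ k) := by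
    refine (Real.rpow_le_rpow (abs_nonneg _) hk1 hp0).trans ?_
    rw [Real.mul_rpow hA0 (by positivity), Real.mul_rpow (by positivity) (by positivity)]
    gcongr
    rw [← Real.rpow_natCast, ← Real.rpow_mul hR0, ← Real.rpow_natCast]
    exact Real.rpow_le_rpow_of_exponent_le hR1 hk
  have he : Real.exp (-δ * u ^ α / α) ≤ 1 := by
    apply Real.exp_le_one_iff.2
    apply div_nonpos_of_nonpos_of_nonneg _ hα0.le
    have : 0 ≤ δ * u ^ α := by positivity
    linarith
  calc _ ≤ A ^ p * ((1 + u ^ (κσ / 2 - α)) ^ p * R ^ k) * (δ * u ^ (α - 1) * 1)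
            * ((2 * π) ^ (-(d : ℝ) / 2) * Real.exp (-(vnorm z) ^ 2 / 2)) := by gcongr
    _ = _ := by rw [hD]; ring
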